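/- Fix n ≥ 2 and lengths l₁,…,l_{n−1} > 0, and consider the truck-with-trailers vector fields h₁, h₂ on U = { y ∈ ℝⁿ : cos y_k ≠ 0 for k = 2,…,n }. Then for every y ∈ U: L_{h₂}L_{h₁}^{i} y₁(y) = 0 for i = 0, 1, …, n−2, and L_{h₂}L_{h₁}^{n−1} y₁(y) = σ_n(y₂,…,yₙ)² · ∏_{j=1}^{n−1} [ l_j⁻¹ σ_j(y₂,…,y_j) ] ≠ 0. -/

import Mathlib

open Set

/-- The `k`-th coordinate (1-based, as in the paper) of `y ∈ ℝⁿ`. -/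
noncomputable def coord {n : ℕ} (y : EuclideanSpace ℝ (Fin n)) (k : ℕ) : ℝ :=
  if h : k - 1 < n then y ⟨k - 1, h⟩ else 0

/-- `σ_i(y₂, …, y_i) = ∏_{k=2}^i sec y_k` (so `σ₁ ≡ 1`). -/
noncomputable def sigmaFun {n : ℕ} (i : ℕ) (y : EuclideanSpace ℝ (Fin n)) : ℝ :=
  ∏ k ∈ Finset.Icc 2 i, (Real.cos (coord y k))⁻¹

/-- `η₁(y₂) = l₁⁻¹ tan y₂` and
`η_i(y₂, …, y_{i+1}) = (l_i⁻¹ tan y_{i+1} − l_{i-1}⁻¹ sin y_i)·σ_i` for `i ≥ 2`. -/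
noncomputable def etaFun {n : ℕ} (l : ℕ → ℝ) (i : ℕ)
    (y : EuclideanSpace ℝ (Fin n)) : ℝ :=
  if i = 1 then (l 1)⁻¹ * Real.tan (coord y 2)
  else ((l i)⁻¹ * Real.tan (coord y (i + 1)) - (l (i - 1))⁻¹ * Real.sin (coord y i)) *
    sigmaFun i y

/-- Lie derivative of a scalar function `φ` along a vector field `h` on `ℝⁿ`. -/
noncomputable def lieDeriv {n : ℕ} (h : EuclideanSpace ℝ (Fin n) → EuclideanSpace ℝ (Fin n))
    (φ : EuclideanSpace ℝ (Fin n) → ℝ) : EuclideanSpace ℝ (Fin n) → ℝ :=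
  fun y => fderiv ℝ φ y (h y)

/-- Repeated Lie derivatives. -/
noncomputable def lieIter {n : ℕ} (h : EuclideanSpace ℝ (Fin n) → EuclideanSpace ℝ (Fin n))
    (φ : EuclideanSpace ℝ (Fin n) → ℝ) : ℕ → EuclideanSpace ℝ (Fin n) → ℝ
  | 0 => φ
  | (i + 1) => lieDeriv h (lieIter h φ i)


open scoped ContDiff

/-- The domain on which every secant in the truck model is defined. -/
def truckDomain (n : ℕ) : Set (EuclideanSpace ℝ (Fin n)) :=
  {y | ∀ k, 2 ≤ k → k ≤ n → Real.cos (coord y k) ≠ 0}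

theorem contDiff_coord {n : ℕ} (k : ℕ) :
    ContDiff ℝ ∞ fun y : EuclideanSpace ℝ (Fin n) => coord y k := by
  unfold coord
  split_ifs <;> fun_prop

theorem isOpen_truckDomain (n : ℕ) : IsOpen (truckDomain n) := by
  have : truckDomain n = ⋂ k ∈ Finset.Icc 2 n, {y | Real.cos (coord y k) ≠ 0} := by
    ext y
    simp [truckDomain]
  rw [this]
  exact isOpen_biInter_finset fun k _ =>
    isOpen_ne_fun (Real.continuous_cos.comp (contDiff_coord k).continuous) continuous_const

theorem contDiffAt_sigmaFun {n i : ℕ} (hi : i ≤ n) {y : EuclideanSpace ℝ (Fin n)}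
    (hy : y ∈ truckDomain n) : ContDiffAt ℝ ∞ (sigmaFun i) y := by
  unfold sigmaFun
  refine contDiffAt_prod fun k hk => ?_
  rw [Finset.mem_Icc] at hk
  exact (contDiff_coord k).contDiffAt.cos.inv (hy k hk.1 (hk.2.trans hi))

theorem contDiffAt_etaFun {n i : ℕ} (l : ℕ → ℝ) (h1 : 1 ≤ i) (hi : i + 1 ≤ n)
    {y : EuclideanSpace ℝ (Fin n)} (hy : y ∈ truckDomain n) :
    ContDiffAt ℝ ∞ (etaFun l i) y := by
  have htan : ContDiffAt ℝ ∞ (fun z : EuclideanSpace ℝ (Fin n) =>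
      Real.tan (coord z (i + 1))) y :=
    ContDiffAt.comp (g := Real.tan) y
      (Real.contDiffAt_tan.2 (hy (i + 1) (by omega) hi)) (contDiff_coord _).contDiffAt
  unfold etaFun
  split_ifs with h
  · subst h
    exact contDiffAt_const.mul htan
  · exact ((contDiffAt_const.mul htan).sub
      (contDiffAt_const.mul (contDiff_coord i).contDiffAt.sin)).mul
      (contDiffAt_sigmaFun (by omega) hy)

theorem coord_add_smul_single {n : ℕ} (y : EuclideanSpace ℝ (Fin n)) (k : Fin n) (t : ℝ)
    {m : ℕ} (hm : 1 ≤ m) :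
    coord (y + t • EuclideanSpace.single k 1) m =
      coord y m + if m = (k : ℕ) + 1 then t else 0 := by
  unfold coord
  split_ifs with h1 h2 h2
  · have : (⟨m - 1, h1⟩ : Fin n) = k := Fin.ext (by simp only; omega)
    simp [this]
  · have : (⟨m - 1, h1⟩ : Fin n) ≠ k := fun h => h2 (by rw [← h]; simp only; omega)
    simp [this]
  · omega
  · simp

theorem sigmaFun_add_smul_single {n i : ℕ} (y : EuclideanSpace ℝ (Fin n)) (k : Fin n) (t : ℝ)
    (hk : i ≤ k) :
    sigmaFun i (y + t • EuclideanSpace.single k 1) = sigmaFun i y := by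
  refine Finset.prod_congr rfl fun m hm => ?_
  rw [Finset.mem_Icc] at hm
  rw [coord_add_smul_single _ _ _ (by omega), if_neg (by omega), add_zero]

theorem etaFun_add_smul_single {n i : ℕ} (l : ℕ → ℝ) (h1 : 1 ≤ i)
    (y : EuclideanSpace ℝ (Fin n)) (k : Fin n) (t : ℝ) (hk : i ≤ k) :
    etaFun l i (y + t • EuclideanSpace.single k 1) = etaFun l i y +
      (l i)⁻¹ * (Real.tan (coord y (i + 1) + if (k : ℕ) = i then t else 0) -
        Real.tan (coord y (i + 1))) * sigmaFun i y := by
  have hs : coord (y + t • EuclideanSpace.single k 1) (i + 1) =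
      coord y (i + 1) + if (k : ℕ) = i then t else 0 := by
    rw [coord_add_smul_single _ _ _ (by omega)]
    simp only [Nat.add_right_cancel_iff, eq_comm]
  generalize (if (k : ℕ) = i then t else 0) = c at hs ⊢
  unfold etaFun
  by_cases h : i = 1
  · subst h
    rw [if_pos rfl, if_pos rfl, hs]
    simp only [sigmaFun, Finset.Icc_eq_empty_of_lt one_lt_two, Finset.prod_empty]
    ring
  · rw [if_neg h, if_neg h, hs, sigmaFun_add_smul_single y k t hk,
      coord_add_smul_single _ _ _ h1, if_neg (by omega), add_zero]
    ring

theorem fderiv_etaFun_single {n i : ℕ} (l : ℕ → ℝ) (h1 : 1 ≤ i)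
    {y : EuclideanSpace ℝ (Fin n)} (hy : y ∈ truckDomain n) (k : Fin n) (hk : i ≤ k) :
    fderiv ℝ (etaFun l i) y (EuclideanSpace.single k 1) =
      if (k : ℕ) = i then (l i)⁻¹ * sigmaFun i y * ((Real.cos (coord y (i + 1)))⁻¹) ^ 2
      else 0 := by
  have hd := (contDiffAt_etaFun l h1 (by omega) hy).differentiableAt (by simp)
  refine HasLineDerivAt.unique (hd.hasFDerivAt.hasLineDerivAt _) ?_
  unfold HasLineDerivAt
  simp_rw [etaFun_add_smul_single l h1 y k _ hk]
  split_ifs with h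
  · have ht : HasDerivAt (fun t : ℝ => Real.tan (coord y (i + 1) + t))
        (1 / Real.cos (coord y (i + 1)) ^ 2) 0 := by
      refine HasDerivAt.comp_const_add (coord y (i + 1)) 0 ?_
      rw [add_zero]
      exact Real.hasDerivAt_tan (hy (i + 1) (by omega) (by omega))
    refine (((ht.sub_const (Real.tan (coord y (i + 1)))).const_mul (l i)⁻¹).mul_const
      (sigmaFun i y)).const_add (etaFun l i y) |>.congr_deriv ?_
    rw [one_div, inv_pow]
    ring
  · exact hasDerivAt_const _ _

theorem map_eq_of_forall_single {n : ℕ} (A : EuclideanSpace ℝ (Fin n) →L[ℝ] ℝ) (i : Fin n)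
    (w : EuclideanSpace ℝ (Fin n)) (hA : ∀ j, i < j → A (EuclideanSpace.single j 1) = 0)
    (hw : ∀ j < i, w j = 0) : A w = w i * A (EuclideanSpace.single i 1) := by
  have hsum : w = ∑ j, w j • EuclideanSpace.single j (1 : ℝ) := by
    ext m
    simp [Finset.sum_apply, Pi.single_apply]
  conv_lhs => rw [hsum]
  rw [map_sum, Finset.sum_eq_single i]
  · simp
  · intro j _ hj
    rcases lt_or_gt_of_ne hj with h | h
    · simp [hw j h]
    · simp [hA j h]
  · simp

theorem fderiv_lieDeriv {n : ℕ}
    {h : EuclideanSpace ℝ (Fin n) → EuclideanSpace ℝ (Fin n)}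
    {φ : EuclideanSpace ℝ (Fin n) → ℝ} {y v : EuclideanSpace ℝ (Fin n)}
    (hφ : ContDiffAt ℝ ∞ φ y) (hh : DifferentiableAt ℝ h y) :
    fderiv ℝ (lieDeriv h φ) y v =
      fderiv ℝ (fun z => fderiv ℝ φ z v) y (h y) + fderiv ℝ φ y (fderiv ℝ h y v) := by
  have hd : DifferentiableAt ℝ (fderiv ℝ φ) y :=
    (hφ.fderiv_right (m := 1) (by norm_cast)).differentiableAt (by simp)
  have hsymm : IsSymmSndFDerivAt ℝ φ y :=
    hφ.isSymmSndFDerivAt (by simp [minSmoothness_of_isRCLikeNormedField]; norm_cast)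
  unfold lieDeriv
  rw [fderiv_clm_apply hd hh, fderiv_clm_apply hd (differentiableAt_const v)]
  simp [hsymm.eq (h y) v, add_comm]

theorem fderiv_apply_coordinate {n : ℕ}
    {h : EuclideanSpace ℝ (Fin n) → EuclideanSpace ℝ (Fin n)} {y v : EuclideanSpace ℝ (Fin n)}
    (hh : DifferentiableAt ℝ h y) (j : Fin n) :
    fderiv ℝ h y v j = fderiv ℝ (fun z => h z j) y v := by
  have := ((EuclideanSpace.proj (𝕜 := ℝ) j).hasFDerivAt.comp y hh.hasFDerivAt).fderiv
  exact (congrArg (fun A => A v) this).symm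

/-- On the truck domain, the `i`-th Lie derivative of the first coordinate is smooth, does not
depend on the coordinates after the `i`-th (counted from `0`), and has the stated partial
derivative in the `i`-th one. -/
theorem lieIter_triangular {n : ℕ} (l : ℕ → ℝ)
    {h : EuclideanSpace ℝ (Fin n) → EuclideanSpace ℝ (Fin n)}
    (hh : ∀ y (j : Fin n), h y j = if (j : ℕ) < n - 1 then etaFun l ((j : ℕ) + 1) y else 0)
    {φ : EuclideanSpace ℝ (Fin n) → ℝ} (hn : 0 < n) (hφ : ∀ y, φ y = y ⟨0, hn⟩)
    {i : ℕ} (hi : i < n) {y : EuclideanSpace ℝ (Fin n)} (hy : y ∈ truckDomain n) :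
    ContDiffAt ℝ ∞ (lieIter h φ i) y ∧ ∀ k : Fin n, i ≤ k →
      fderiv ℝ (lieIter h φ i) y (EuclideanSpace.single k 1) =
        if (k : ℕ) = i then ∏ j ∈ Finset.Icc 1 i,
          ((l j)⁻¹ * sigmaFun j y * ((Real.cos (coord y (j + 1)))⁻¹) ^ 2)
        else 0 := by
  induction i generalizing y with
  | zero =>
    have hproj : φ = EuclideanSpace.proj (𝕜 := ℝ) (⟨0, hn⟩ : Fin n) := funext hφ
    simp only [lieIter, hproj]
    refine ⟨ContinuousLinearMap.contDiff _ |>.contDiffAt, fun k _ => ?_⟩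
    rw [ContinuousLinearMap.fderiv]
    simp [PiLp.single_apply, Fin.ext_iff, eq_comm]
  | succ i ih =>
    have hcoord : ∀ j : Fin n, ContDiffAt ℝ ∞ (fun z => h z j) y := by
      intro j
      simp_rw [hh]
      split_ifs with hj
      · exact contDiffAt_etaFun l (by omega) (by omega) hy
      · exact contDiffAt_const
    have hsmooth : ContDiffAt ℝ ∞ h y := contDiffAt_euclidean.2 hcoord
    have hdiff : DifferentiableAt ℝ h y := hsmooth.differentiableAt (by simp)
    obtain ⟨hc, hD⟩ := ih (by omega) hy
    refine ⟨(hc.fderiv_right (m := ∞) (by simp)).clm_apply hsmooth, fun k hk => ?_⟩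
    have hzero : fderiv ℝ (fun z => fderiv ℝ (lieIter h φ i) z (EuclideanSpace.single k 1)) y
        = 0 := by
      have : (fun z => fderiv ℝ (lieIter h φ i) z (EuclideanSpace.single k 1)) =ᶠ[nhds y]
          fun _ => 0 := by
        filter_upwards [(isOpen_truckDomain n).mem_nhds hy] with z hz
        rw [(ih (by omega) hz).2 k (by omega), if_neg (by omega)]
      rw [this.fderiv_eq]
      simp
    have hpartial : ∀ j : Fin n, (j : ℕ) ≤ i →
        fderiv ℝ h y (EuclideanSpace.single k 1) j =
          if (k : ℕ) = j + 1 then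
            (l (j + 1))⁻¹ * sigmaFun (j + 1) y * ((Real.cos (coord y (j + 1 + 1)))⁻¹) ^ 2
          else 0 := by
      intro j hj
      rw [fderiv_apply_coordinate hdiff]
      simp_rw [hh, if_pos (show (j : ℕ) < n - 1 by omega)]
      exact fderiv_etaFun_single l (by omega) hy k (by omega)
    change fderiv ℝ (lieDeriv h (lieIter h φ i)) y _ = _
    rw [fderiv_lieDeriv hc hdiff, hzero, zero_apply, zero_add,
      map_eq_of_forall_single _ ⟨i, by omega⟩, hpartial _ le_rfl, hD _ le_rfl, if_pos rfl]
    · rw [Finset.prod_Icc_succ_top (by omega)]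
      split_ifs <;> ring
    · intro j hj
      rw [Fin.lt_def] at hj
      rw [hD j hj.le, if_neg hj.ne']
    · intro j hj
      rw [Fin.lt_def] at hj
      rw [hpartial j hj.le, if_neg (by simp only at hj; omega)]

theorem prod_sec_sq_eq_sigmaFun_sq {n : ℕ} (y : EuclideanSpace ℝ (Fin n)) (i : ℕ) :
    ∏ j ∈ Finset.Icc 1 i, ((Real.cos (coord y (j + 1)))⁻¹) ^ 2 = sigmaFun (i + 1) y ^ 2 := by
  rw [Finset.prod_pow, sigmaFun]
  congr 1
  rw [← Finset.image_add_right_Icc 1 i 1, Finset.prod_image (by simp)]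

theorem sigmaFun_ne_zero {n i : ℕ} (hi : i ≤ n) {y : EuclideanSpace ℝ (Fin n)}
    (hy : y ∈ truckDomain n) : sigmaFun i y ≠ 0 := by
  refine Finset.prod_ne_zero_iff.2 fun k hk => ?_
  rw [Finset.mem_Icc] at hk
  exact inv_ne_zero (hy k hk.1 (hk.2.trans hi))

/-- The truck with multiple trailers satisfies the relative-degree (maneuverability)
conditions: `L_{h₂} L_{h₁}^i y₁ = 0` on `U` for `i = 0, …, n−2`, and
`L_{h₂} L_{h₁}^{n−1} y₁ = σ_n² ∏_{j=1}^{n-1} l_j⁻¹ σ_j ≠ 0` on `U`. -/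
theorem stmt15 {n : ℕ} (hn : 2 ≤ n)
    (l : ℕ → ℝ) (hl : ∀ i, 1 ≤ i → i ≤ n - 1 → 0 < l i)
    (h₁ h₂ : EuclideanSpace ℝ (Fin n) → EuclideanSpace ℝ (Fin n))
    (hh₁ : ∀ y (j : Fin n), h₁ y j = if (j : ℕ) < n - 1 then etaFun l ((j : ℕ) + 1) y else 0)
    (hh₂ : ∀ y (j : Fin n), h₂ y j = if (j : ℕ) = n - 1 then 1 else 0)
    (y₁ : EuclideanSpace ℝ (Fin n) → ℝ) (hy₁ : ∀ y, y₁ y = y ⟨0, by omega⟩) :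
    ∀ y : EuclideanSpace ℝ (Fin n),
      (∀ k, 2 ≤ k → k ≤ n → Real.cos (coord y k) ≠ 0) →
      (∀ i < n - 1, lieDeriv h₂ (lieIter h₁ y₁ i) y = 0) ∧
      lieDeriv h₂ (lieIter h₁ y₁ (n - 1)) y =
        (sigmaFun n y) ^ 2 * ∏ j ∈ Finset.Icc 1 (n - 1), (l j)⁻¹ * sigmaFun j y ∧
      lieDeriv h₂ (lieIter h₁ y₁ (n - 1)) y ≠ 0 := by
  intro y hy
  have hsingle : h₂ y = EuclideanSpace.single ⟨n - 1, by omega⟩ 1 := by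
    ext j
    simp [hh₂, PiLp.single_apply, Fin.ext_iff]
  have htri := fun i (hi : i < n) =>
    (lieIter_triangular l hh₁ (by omega) hy₁ hi hy).2 ⟨n - 1, by omega⟩ (by simp only; omega)
  have hval : lieDeriv h₂ (lieIter h₁ y₁ (n - 1)) y =
      (sigmaFun n y) ^ 2 * ∏ j ∈ Finset.Icc 1 (n - 1), (l j)⁻¹ * sigmaFun j y := by
    rw [lieDeriv, hsingle, htri (n - 1) (by omega), if_pos rfl, Finset.prod_mul_distrib,
      prod_sec_sq_eq_sigmaFun_sq, Nat.sub_add_cancel (by omega), mul_comm]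
  refine ⟨fun i hi => ?_, hval, ?_⟩
  · rw [lieDeriv, hsingle, htri i (by omega), if_neg (by simp only; omega)]
  · rw [hval]
    refine mul_ne_zero (pow_ne_zero 2 (sigmaFun_ne_zero le_rfl hy))
      (Finset.prod_ne_zero_iff.2 fun j hj => ?_)
    rw [Finset.mem_Icc] at hj
    exact mul_ne_zero (inv_ne_zero (hl j hj.1 hj.2).ne') (sigmaFun_ne_zero (by omega) hy)
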